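/- Subpath extraction at a fixed height level: let H₀, …, H_ℓ be a valid stack sequence for adaptation functions f₀, …, f_{ℓ−1}, and let i < k be positions with |H_i| = |H_k| = h ≥ 1 and |H_p| > h for every p with i < p < k. Then the bottom h − 1 symbols of H_i and of H_k coincide, and the function sequence f_i, …, f_{k−1} admits a valid stack sequence starting from the single-protocol stack [top(H_i)] and ending at the single-protocol stack [top(H_k)]. -/

import Mathlib

/-- An adaptation function over a protocol set `A`: a conversion `(a→b)`,
an encapsulation `(a→ab)`, or a decapsulation `(a→ab)‾`. -/
inductive AdaptFun (A : Type) where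
  | conv : A → A → AdaptFun A
  | encap : A → A → AdaptFun A
  | decap : A → A → AdaptFun A
deriving DecidableEq

/-- The partial action of an adaptation function on a protocol stack
(a list whose head is the top of the stack). -/
def AdaptFun.apply {A : Type} [DecidableEq A] : AdaptFun A → List A → Option (List A)
  | .conv a b, x :: T => if x = a then some (b :: T) else none
  | .encap a b, x :: T => if x = a then some (b :: a :: T) else none
  | .decap a b, y :: x :: T => if y = b ∧ x = a then some (a :: T) else none
  | _, _ => none

/-- `H₀, …, H_ℓ` is a valid stack sequence for `f₀, …, f_{ℓ-1}`: for every `i < ℓ`,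
the action of `f i` on `H i` is defined and equals `H (i+1)`. -/
def ValidSeq {A : Type} [DecidableEq A] (f : ℕ → AdaptFun A) (H : ℕ → List A) (ℓ : ℕ) : Prop :=
  ∀ i < ℓ, (f i).apply (H i) = some (H (i + 1))

/-- An adaptation function whose result keeps a symbol above `T` acts on `S ++ T` by acting
on `S` alone. -/
theorem AdaptFun.apply_append_eq_some {A : Type} [DecidableEq A] {f : AdaptFun A}
    {S T L : List A} (hS : S ≠ []) (hf : f.apply (S ++ T) = some L)
    (hL : T.length < L.length) : ∃ S', S' ≠ [] ∧ L = S' ++ T ∧ f.apply S = some S' := by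
  rcases S with _ | ⟨x, S⟩
  · exact absurd rfl hS
  cases f with
  | conv a b =>
    simp only [List.cons_append, AdaptFun.apply, Option.ite_none_right_eq_some,
      Option.some.injEq] at hf
    obtain ⟨rfl, rfl⟩ := hf
    exact ⟨b :: S, by simp, by simp, by simp [AdaptFun.apply]⟩
  | encap a b =>
    simp only [List.cons_append, AdaptFun.apply, Option.ite_none_right_eq_some,
      Option.some.injEq] at hf
    obtain ⟨rfl, rfl⟩ := hf
    exact ⟨b :: x :: S, by simp, by simp, by simp [AdaptFun.apply]⟩
  | decap a b =>
    rcases S with _ | ⟨y, S⟩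
    · rcases T with _ | ⟨y, T⟩
      · simp [AdaptFun.apply] at hf
      · simp only [List.cons_append, List.nil_append, AdaptFun.apply,
          Option.ite_none_right_eq_some, Option.some.injEq] at hf
        obtain ⟨-, rfl⟩ := hf
        simp at hL
    · simp only [List.cons_append, AdaptFun.apply, Option.ite_none_right_eq_some,
        Option.some.injEq] at hf
      obtain ⟨⟨rfl, rfl⟩, rfl⟩ := hf
      exact ⟨y :: S, by simp, by simp, by simp [AdaptFun.apply]⟩

/-- Subpath extraction at a fixed height level: if `|H i| = |H k| = h ≥ 1` and all strictly
intermediate positions have height `> h`, then the bottom `h - 1` symbols of `H i` and `H k`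
coincide, and `f i, …, f (k-1)` admits a valid stack sequence from the single-protocol
stack `[top (H i)]` to the single-protocol stack `[top (H k)]`. -/
theorem validSeq_subpath_extraction {A : Type} [DecidableEq A]
    (f : ℕ → AdaptFun A) (H : ℕ → List A) (ℓ : ℕ) (hv : ValidSeq f H ℓ)
    (i k h : ℕ) (hik : i < k) (hk : k ≤ ℓ)
    (hi : (H i).length = h) (hkh : (H k).length = h) (h1 : 1 ≤ h)
    (hmid : ∀ p, i < p → p < k → h < (H p).length) :
    (H i).drop 1 = (H k).drop 1 ∧
    ∃ G : ℕ → List A, G 0 = (H i).take 1 ∧ G (k - i) = (H k).take 1 ∧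
      ValidSeq (fun p => f (i + p)) G (k - i) := by
  set T := (H i).drop 1 with hT
  have hTlen : T.length = h - 1 := by simp [hT, hi]
  have hlong : ∀ p ≤ k - i, T.length < (H (i + p)).length := by
    intro p hp
    rcases Nat.eq_zero_or_pos p with rfl | hp0
    · rw [Nat.add_zero]; omega
    · rcases hp.lt_or_eq with hlt | rfl
      · have := hmid (i + p) (by omega) (by omega)
        omega
      · rw [Nat.add_sub_cancel' hik.le]; omega
  have hsplit : ∀ p ≤ k - i, ∃ S, S ≠ [] ∧ H (i + p) = S ++ T := by
    intro p
    induction p with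
    | zero =>
      intro _
      refine ⟨(H i).take 1, ?_, (List.take_append_drop 1 (H i)).symm⟩
      rw [← List.length_pos_iff, List.length_take]
      omega
    | succ p ih =>
      intro hp
      obtain ⟨S, hS, hST⟩ := ih (by omega)
      have hstep := hv (i + p) (by omega)
      rw [hST] at hstep
      obtain ⟨S', hS', hST', -⟩ :=
        AdaptFun.apply_append_eq_some hS hstep (hlong (p + 1) hp)
      exact ⟨S', hS', hST'⟩
  have hend : ∃ x, H k = x :: T := by
    obtain ⟨S, -, hST⟩ := hsplit (k - i) le_rfl
    rw [Nat.add_sub_cancel' hik.le] at hST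
    have hlen : S.length = 1 := by
      have := congrArg List.length hST
      rw [List.length_append] at this
      omega
    obtain ⟨x, rfl⟩ := List.length_eq_one_iff.mp hlen
    exact ⟨x, hST⟩
  refine ⟨by obtain ⟨x, hx⟩ := hend; simp [hx],
    fun p => (H (i + p)).take ((H (i + p)).length - T.length), ?_, ?_, ?_⟩
  · have : (H i).length - T.length = 1 := by omega
    simp only [Nat.add_zero, this]
  · have : (H k).length - T.length = 1 := by omega
    simp only [Nat.add_sub_cancel' hik.le, this]
  · intro p hp
    obtain ⟨S, hS, hST⟩ := hsplit p hp.le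
    have hstep := hv (i + p) (by omega)
    rw [hST] at hstep
    obtain ⟨S', -, hST', hf⟩ :=
      AdaptFun.apply_append_eq_some hS hstep (hlong (p + 1) hp)
    simp only [← Nat.add_assoc, hST, hST', List.length_append, Nat.add_sub_cancel,
      List.take_left]
    exact hf
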